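/- arXiv:2405.19157 — 5 statements merged into one kernel-verified Lean document; each statement's English description precedes it below -/
import Mathlib

section
/- In a stable inference system, every interleaving of two proofs is a proof: if P and Q are proofs and S is an interleaving of P and Q, then S is a proof. -/
def IsProof {κ : Type} (Rule : κ → List κ → Prop) (P : List κ) : Prop :=
  ∀ i : Fin P.length, Rule (P.get i) (P.take i.1)

def Stable {κ : Type} (Rule : κ → List κ → Prop) : Prop :=
  ∀ (c : κ) (P Q : List κ), P.Sublist Q → Rule c P → Rule c Q

inductive Interleave {κ : Type} : List κ → List κ → List κ → Prop
  | nil : Interleave [] [] []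
  | left (p : κ) {P Q S : List κ} : Interleave P Q S → Interleave (p :: P) Q (p :: S)
  | right (q : κ) {P Q S : List κ} : Interleave P Q S → Interleave P (q :: Q) (q :: S)

theorem Interleave.exists_get_eq_and_take_sublist {κ : Type} {P Q S : List κ}
    (h : Interleave P Q S) (i : Fin S.length) :
    (∃ j : Fin P.length, P.get j = S.get i ∧ (P.take j.1).Sublist (S.take i.1)) ∨
      ∃ j : Fin Q.length, Q.get j = S.get i ∧ (Q.take j.1).Sublist (S.take i.1) := by
  induction h with
  | nil => exact i.elim0
  | left p _ ih =>
    refine Fin.cases (Or.inl ⟨0, rfl, .slnil⟩) (fun i => ?_) i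
    rcases ih i with ⟨j, hj, hs⟩ | ⟨j, hj, hs⟩
    · exact Or.inl ⟨j.succ, hj, hs.cons_cons p⟩
    · exact Or.inr ⟨j, hj, hs.cons p⟩
  | right q _ ih =>
    refine Fin.cases (Or.inr ⟨0, rfl, .slnil⟩) (fun i => ?_) i
    rcases ih i with ⟨j, hj, hs⟩ | ⟨j, hj, hs⟩
    · exact Or.inl ⟨j, hj, hs.cons q⟩
    · exact Or.inr ⟨j.succ, hj, hs.cons_cons q⟩

theorem interleaving_of_proofs_is_proof {κ : Type} (Rule : κ → List κ → Prop)
    (hstable : Stable Rule) (P Q S : List κ)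
    (hP : IsProof Rule P) (hQ : IsProof Rule Q)
    (hS : Interleave P Q S) :
    IsProof Rule S := by
  intro i
  rcases hS.exists_get_eq_and_take_sublist i with ⟨j, hj, hs⟩ | ⟨j, hj, hs⟩
  · exact hj ▸ hstable _ _ _ hs (hP j)
  · exact hj ▸ hstable _ _ _ hs (hQ j)
end

section
/- In a stable inference system, the set D of derivable conclusions is the smallest inference-closed set: (i) D is inference-closed, i.e., whenever Rule c L holds for some list L all of whose elements belong to D, then c ∈ D; and (ii) D is contained in every inference-closed set S. Hence the closure of the inference rules is well-defined. -/
def Derivable {κ : Type} (Rule : κ → List κ → Prop) (c : κ) : Prop :=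
  ∃ P, IsProof Rule P ∧ c ∈ P

def InferenceClosed {κ : Type} (Rule : κ → List κ → Prop) (S : Set κ) : Prop :=
  ∀ (c : κ) (L : List κ), (∀ x ∈ L, x ∈ S) → Rule c L → c ∈ S

theorem isProof_append_singleton {κ : Type} {Rule : κ → List κ → Prop} {P : List κ} {c : κ} :
    IsProof Rule (P ++ [c]) ↔ IsProof Rule P ∧ Rule c P := by
  constructor
  · intro h
    refine ⟨fun i => ?_, ?_⟩
    · have hi := h ⟨i.1, by simp⟩
      simpa [List.getElem_append_left i.2, List.take_append_of_le_length i.2.le] using hi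
    · simpa using h ⟨P.length, by simp⟩
  · rintro ⟨hP, hc⟩ ⟨i, hi⟩
    rcases Nat.lt_or_ge i P.length with h | h
    · simpa [List.getElem_append_left h, List.take_append_of_le_length h.le] using hP ⟨i, h⟩
    · obtain rfl : i = P.length := by simp at hi; omega
      simpa using hc

theorem IsProof.append {κ : Type} {Rule : κ → List κ → Prop} (hstable : Stable Rule)
    {P Q : List κ} (hP : IsProof Rule P) (hQ : IsProof Rule Q) : IsProof Rule (P ++ Q) := by
  induction Q using List.reverseRecOn with
  | nil => simpa using hP
  | append_singleton Q c ih =>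
    obtain ⟨hQ, hc⟩ := isProof_append_singleton.1 hQ
    rw [← List.append_assoc]
    exact isProof_append_singleton.2
      ⟨ih hQ, hstable c Q (P ++ Q) (List.sublist_append_right P Q) hc⟩

theorem exists_isProof_sublist {κ : Type} {Rule : κ → List κ → Prop} (hstable : Stable Rule)
    {L : List κ} (hL : ∀ x ∈ L, Derivable Rule x) : ∃ P, IsProof Rule P ∧ L.Sublist P := by
  induction L with
  | nil => exact ⟨[], fun i => i.elim0, List.Sublist.refl _⟩
  | cons x L ih =>
    obtain ⟨P, hP, hx⟩ := hL x List.mem_cons_self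
    obtain ⟨Q, hQ, hLQ⟩ := ih fun y hy => hL y (List.mem_cons_of_mem x hy)
    exact ⟨P ++ Q, hP.append hstable hQ, (List.singleton_sublist.2 hx).append hLQ⟩

theorem IsProof.mem_of_inferenceClosed {κ : Type} {Rule : κ → List κ → Prop} {S : Set κ}
    (hS : InferenceClosed Rule S) {P : List κ} (hP : IsProof Rule P) : ∀ x ∈ P, x ∈ S := by
  induction P using List.reverseRecOn with
  | nil => simp
  | append_singleton P c ih =>
    obtain ⟨hP, hc⟩ := isProof_append_singleton.1 hP
    intro x hx
    rcases List.mem_append.1 hx with hx | hx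
    · exact ih hP x hx
    · rw [List.mem_singleton.1 hx]
      exact hS c P (ih hP) hc

theorem derivable_is_smallest_closed {κ : Type} (Rule : κ → List κ → Prop)
    (hstable : Stable Rule) :
    InferenceClosed Rule {c | Derivable Rule c} ∧
    (∀ S : Set κ, InferenceClosed Rule S → {c | Derivable Rule c} ⊆ S) := by
  refine ⟨fun c L hL hc => ?_, fun S hS c ⟨P, hP, hc⟩ => hP.mem_of_inferenceClosed hS c hc⟩
  obtain ⟨P, hP, hLP⟩ := exists_isProof_sublist hstable hL
  exact ⟨P ++ [c], isProof_append_singleton.2 ⟨hP, hstable c L P hLP hc⟩, by simp⟩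
end

section
/- Double strong negation does not weaken a condition under coherent valuations: if the proof-atom valuation M is coherent, then for every formula C and every pure valuation v, if sneg (sneg C) evaluates to true under (M, v), then C evaluates to true under (M, v). -/
inductive Fml (Atom Pure I : Type) : Type
  | memP (s : Bool) (a : Atom) : Fml Atom Pure I
  | nmemP (s : Bool) (a : Atom) : Fml Atom Pure I
  | pure (p : Pure) : Fml Atom Pure I
  | npure (p : Pure) : Fml Atom Pure I
  | and (A B : Fml Atom Pure I) : Fml Atom Pure I
  | or (A B : Fml Atom Pure I) : Fml Atom Pure I
  | all (f : I → Fml Atom Pure I) : Fml Atom Pure I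
  | ex (f : I → Fml Atom Pure I) : Fml Atom Pure I

namespace Fml

variable {Atom Pure I : Type}

def sneg : Fml Atom Pure I → Fml Atom Pure I
  | memP s a => memP (!s) a
  | nmemP s a => memP s a
  | pure p => npure p
  | npure p => pure p
  | and A B => or A.sneg B.sneg
  | or A B => and A.sneg B.sneg
  | all f => ex fun i => (f i).sneg
  | ex f => all fun i => (f i).sneg

def nnfNeg : Fml Atom Pure I → Fml Atom Pure I
  | memP s a => nmemP s a
  | nmemP s a => memP s a
  | pure p => npure p
  | npure p => pure p
  | and A B => or A.nnfNeg B.nnfNeg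
  | or A B => and A.nnfNeg B.nnfNeg
  | all f => ex fun i => (f i).nnfNeg
  | ex f => all fun i => (f i).nnfNeg

def PosOnly : Fml Atom Pure I → Prop
  | memP _ _ => True
  | nmemP _ _ => False
  | pure _ => True
  | npure _ => True
  | and A B => A.PosOnly ∧ B.PosOnly
  | or A B => A.PosOnly ∧ B.PosOnly
  | all f => ∀ i, (f i).PosOnly
  | ex f => ∀ i, (f i).PosOnly

def NegOnly : Fml Atom Pure I → Prop
  | memP _ _ => False
  | nmemP _ _ => True
  | pure _ => True
  | npure _ => True
  | and A B => A.NegOnly ∧ B.NegOnly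
  | or A B => A.NegOnly ∧ B.NegOnly
  | all f => ∀ i, (f i).NegOnly
  | ex f => ∀ i, (f i).NegOnly

def eval (M : Bool → Atom → Prop) (v : Pure → Prop) : Fml Atom Pure I → Prop
  | memP s a => M s a
  | nmemP s a => ¬ M s a
  | pure p => v p
  | npure p => ¬ v p
  | and A B => A.eval M v ∧ B.eval M v
  | or A B => A.eval M v ∨ B.eval M v
  | all f => ∀ i, (f i).eval M v
  | ex f => ∃ i, (f i).eval M v

end Fml

theorem sneg_sneg_implies_of_coherent {Atom Pure I : Type}
    (M : Bool → Atom → Prop) (hM : ∀ a, ¬ (M true a ∧ M false a)) :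
    ∀ (C : Fml Atom Pure I) (v : Pure → Prop),
      C.sneg.sneg.eval M v → C.eval M v := by
  intro C v
  induction C with
  | memP s a => simp [Fml.sneg]
  | nmemP s a =>
    intro h hs
    cases s
    · exact hM a ⟨h, hs⟩
    · exact hM a ⟨hs, h⟩
  | pure p => exact id
  | npure p => exact id
  | and A B ihA ihB => exact And.imp ihA ihB
  | or A B ihA ihB => exact Or.imp ihA ihB
  | all f ih => exact forall_imp ih
  | ex f ih => exact Exists.imp ih
end

section
/- In a stable inference system over conclusions κ = Bool × Tag × Lit, let d : Tag, and suppose Cp, Cm : Lit → List κ → Prop satisfy, for all q and P: Rule (true, d, q) P ↔ Cp q P and Rule (false, d, q) P ↔ Cm q P. Then the following are equivalent: (i) there is a literal q such that (true, d, q) and (false, d, q) are both derivable (the tag d is incoherent); (ii) there exist a literal q and a proof P with Cp q P and Cm q P (the conjunction of the two applicability conditions is proof-satisfiable). Equivalently, Cp ∧ Cm is proof-unsatisfiable if and only if d is coherent. -/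
theorem IsProof.rule_of_mem {κ : Type} {Rule : κ → List κ → Prop} (hstable : Stable Rule)
    {P : List κ} (hP : IsProof Rule P) {c : κ} (hc : c ∈ P) : Rule c P := by
  obtain ⟨i, rfl⟩ := List.get_of_mem hc
  exact hstable _ _ _ (List.take_sublist _ _) (hP i)

theorem IsProof.concat {κ : Type} {Rule : κ → List κ → Prop} {P : List κ} {c : κ}
    (hP : IsProof Rule P) (hc : Rule c P) : IsProof Rule (P ++ [c]) := by
  rintro ⟨i, hi⟩
  rw [List.length_append, List.length_singleton] at hi
  rcases Nat.lt_succ_iff_lt_or_eq.mp hi with h | rfl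
  · simpa [List.getElem_append_left h, List.take_append_of_le_length h.le] using hP ⟨i, h⟩
  · simpa using hc

theorem IsProof.derivable {κ : Type} {Rule : κ → List κ → Prop} {P : List κ} {c : κ}
    (hP : IsProof Rule P) (hc : Rule c P) : Derivable Rule c :=
  ⟨P ++ [c], hP.concat hc, by simp⟩

theorem incoherent_iff_proof_satisfiable {Tag Lit : Type}
    (Rule : (Bool × Tag × Lit) → List (Bool × Tag × Lit) → Prop)
    (hstable : Stable Rule) (d : Tag)
    (Cp Cm : Lit → List (Bool × Tag × Lit) → Prop)
    (hp : ∀ q P, Rule (true, d, q) P ↔ Cp q P)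
    (hm : ∀ q P, Rule (false, d, q) P ↔ Cm q P) :
    (∃ q, Derivable Rule (true, d, q) ∧ Derivable Rule (false, d, q)) ↔
      (∃ q P, IsProof Rule P ∧ Cp q P ∧ Cm q P) := by
  constructor
  · rintro ⟨q, ⟨P, hP, hPq⟩, Q, hQ, hQq⟩
    have hPQ := hP.append hstable hQ
    exact ⟨q, P ++ Q, hPQ,
      (hp _ _).mp (hPQ.rule_of_mem hstable (List.mem_append_left _ hPq)),
      (hm _ _).mp (hPQ.rule_of_mem hstable (List.mem_append_right _ hQq))⟩
  · rintro ⟨q, P, hP, hpq, hmq⟩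
    exact ⟨q, hP.derivable ((hp q P).mpr hpq), hP.derivable ((hm q P).mpr hmq)⟩
end

section
/- In a well-behaved defeasible logic, the conjunction of an applicability condition and its strong negation is proof-unsatisfiable. Precisely: under the setting of the coherence theorem — conclusions κ = Bool × Tag × Lit, pre-defined sets X : Name → Bool → (Tag × Lit) → Prop, pure-atom valuation v, proof atoms Atom = (Tag × Lit) × Option Name, valuation M_P given by M_P s ((d', p), none) := ((s, d', p) ∈ P) and M_P s ((d', p), some n) := X n s (d', p), inference system Rule (true, d, q) P := eval (C d q) under (M_P, v) and Rule (false, d, q) P := eval (sneg (C d q)) under (M_P, v), with the system stable and every pre-defined set coherent — for every tag d and literal q there is no proof P such that both C d q and sneg (C d q) evaluate to true under (M_P, v). -/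
/-- A condition and its strong negation can hold together only if some proof atom is valued
inconsistently. -/
theorem Fml.exists_clash_of_eval_sneg {Atom Pure I : Type} {M : Bool → Atom → Prop}
    {v : Pure → Prop} {A : Fml Atom Pure I} (h : A.eval M v) (hs : A.sneg.eval M v) :
    ∃ a, M true a ∧ M false a := by
  induction A with
  | memP s a => cases s <;> exact ⟨a, by simp_all [Fml.eval, Fml.sneg]⟩
  | nmemP s a => exact absurd hs h
  | pure p => exact absurd h hs
  | npure p => exact absurd hs h
  | and A B ihA ihB => exact hs.elim (ihA h.1) (ihB h.2)
  | or A B ihA ihB => exact h.elim (fun hA => ihA hA hs.1) (fun hB => ihB hB hs.2)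
  | all f ih =>
    obtain ⟨i, hi⟩ := hs
    exact ih i (h i) hi
  | ex f ih =>
    obtain ⟨i, hi⟩ := h
    exact ih i hi (hs i)

theorem IsProof.take {κ : Type} {Rule : κ → List κ → Prop} {P : List κ} (hP : IsProof Rule P)
    (n : ℕ) : IsProof Rule (P.take n) := by
  rintro ⟨i, hi⟩
  have hlt : i < n ∧ i < P.length := by simpa using hi
  simpa [List.take_take, hlt.1.le] using hP ⟨i, hlt.2⟩

/-- In a stable system, any two members of a proof are inferred from a common proper prefix. -/
theorem IsProof.exists_take_rule {κ : Type} {Rule : κ → List κ → Prop} (hstable : Stable Rule)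
    {P : List κ} (hP : IsProof Rule P) {b c : κ} (hb : b ∈ P) (hc : c ∈ P) :
    ∃ n < P.length, Rule b (P.take n) ∧ Rule c (P.take n) := by
  obtain ⟨i, rfl⟩ := List.get_of_mem hb
  obtain ⟨j, rfl⟩ := List.get_of_mem hc
  exact ⟨max i.1 j.1, max_lt i.2 j.2,
    hstable _ _ _ (List.take_sublist_take_left (le_max_left _ _)) (hP i),
    hstable _ _ _ (List.take_sublist_take_left (le_max_right _ _)) (hP j)⟩

theorem applicability_condition_conj_sneg_proof_unsat {Tag Lit Pure I Name : Type}
    (Rule : (Bool × Tag × Lit) → List (Bool × Tag × Lit) → Prop)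
    (X : Name → Bool → (Tag × Lit) → Prop)
    (v : Pure → Prop)
    (C : Tag → Lit → Fml ((Tag × Lit) × Option Name) Pure I)
    (MP : List (Bool × Tag × Lit) → Bool → (Tag × Lit) × Option Name → Prop)
    (hMP : ∀ P s x, MP P s x =
      (match x.2 with
       | none => (s, x.1) ∈ P
       | some n => X n s x.1))
    (hp : ∀ (d : Tag) (q : Lit) (P : List (Bool × Tag × Lit)),
      Rule (true, d, q) P ↔ (C d q).eval (MP P) v)
    (hm : ∀ (d : Tag) (q : Lit) (P : List (Bool × Tag × Lit)),
      Rule (false, d, q) P ↔ (C d q).sneg.eval (MP P) v)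
    (hstable : Stable Rule)
    (hXcoherent : ∀ (n : Name) (a : Tag × Lit), ¬ (X n true a ∧ X n false a)) :
    ∀ (d : Tag) (q : Lit), ¬ ∃ P : List (Bool × Tag × Lit), IsProof Rule P ∧
      (C d q).eval (MP P) v ∧ (C d q).sneg.eval (MP P) v := by
  rintro d q ⟨P, hP, h, hs⟩
  induction hk : P.length using Nat.strong_induction_on generalizing d q P with
  | _ k ih =>
    obtain ⟨⟨⟨d', q'⟩, o⟩, ht, hf⟩ := Fml.exists_clash_of_eval_sneg h hs
    rw [hMP] at ht hf
    cases o with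
    | some n => exact hXcoherent n _ ⟨ht, hf⟩
    | none =>
      obtain ⟨n, hn, hrt, hrf⟩ := hP.exists_take_rule hstable ht hf
      exact ih _ (by rw [List.length_take]; omega) d' q' (P.take n) (hP.take n)
        ((hp _ _ _).1 hrt) ((hm _ _ _).1 hrf) rfl
end
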